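/- Let S be a finite family of curves in the plane, each colored red or blue, such that no two curves of the same color intersect, and let C be a family of pairwise disjoint curves. Then the VC-dimension of the intersection hypergraph H(S, C) is at most 8. -/

import Mathlib

open Set

/-- Points of the plane. -/
abbrev Pt : Type := ℝ × ℝ

/-- A curve: the image of an injective continuous map from `[0,1]` to the plane. -/
def IsCurve (s : Set Pt) : Prop :=
  ∃ f : ℝ → Pt, ContinuousOn f (Set.Icc 0 1) ∧ Set.InjOn f (Set.Icc 0 1) ∧
    s = f '' Set.Icc 0 1

/-- A simple polygonal chain consisting of finitely many line segments. -/
def IsPolygonalCurve (s : Set Pt) : Prop :=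
  IsCurve s ∧ ∃ P : Finset (Pt × Pt), s = ⋃ p ∈ P, segment ℝ p.1 p.2

/-- `δ` is the change of a continuous logarithm of `f - w` along `[0, 1]`. -/
def IsLogIncrement (f : ℝ → ℂ) (w δ : ℂ) : Prop :=
  ∃ l : ℝ → ℂ, Continuous l ∧ (∀ s, Complex.exp (l s) = f s - w) ∧ l 1 - l 0 = δ

theorem exists_continuous_log {g : ℝ × ℝ → ℂ} (hg : Continuous g) (h0 : ∀ x, g x ≠ 0) :
    ∃ L : ℝ × ℝ → ℂ, Continuous L ∧ ∀ x, Complex.exp (L x) = g x := by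
  obtain ⟨F, ⟨-, hF⟩, -⟩ := Complex.isCoveringMapOn_exp.existsUnique_continuousMap_lifts
    ⟨g, hg⟩ (Complex.exp_log (h0 0)) (fun x ↦ h0 x)
  exact ⟨F, F.continuous, fun x ↦ congrFun hF x⟩

theorem exists_isLogIncrement {f : ℝ → ℂ} (hf : Continuous f) {w : ℂ} (h : ∀ s, f s ≠ w) :
    ∃ δ, IsLogIncrement f w δ := by
  obtain ⟨L, hL, hexp⟩ := exists_continuous_log (g := fun x ↦ f x.1 - w) (by fun_prop)
    (fun x ↦ sub_ne_zero.2 (h x.1))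
  exact ⟨_, fun s ↦ L (s, 0), by fun_prop, fun s ↦ hexp (s, 0), rfl⟩

theorem IsLogIncrement.unique {f : ℝ → ℂ} {w δ δ' : ℂ} (h : IsLogIncrement f w δ)
    (h' : IsLogIncrement f w δ') : δ = δ' := by
  obtain ⟨l, hl, hexp, rfl⟩ := h
  obtain ⟨l', hl', hexp', rfl⟩ := h'
  have key : l = fun s ↦ l' s + (l 0 - l' 0) := by
    refine Complex.isCoveringMap_exp.eq_of_comp_eq hl (by fun_prop) ?_ 0 (by simp)
    funext s
    apply Subtype.ext
    simp only [Function.comp_apply, Complex.exp_add, Complex.exp_sub, hexp, hexp']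
    rw [div_self, mul_one]
    rw [← hexp 0]
    exact Complex.exp_ne_zero _
  have := congrFun key 1
  rw [this]
  ring

/-- The winding of `f s - g t` around the boundary of the unit square vanishes. -/
theorem IsLogIncrement.square {f g : ℝ → ℂ} (hf : Continuous f) (hg : Continuous g)
    (hfg : ∀ s t, f s ≠ g t) {p q r s : ℂ} (hp : IsLogIncrement f (g 0) p)
    (hq : IsLogIncrement f (g 1) q) (hr : IsLogIncrement g (f 1) r)
    (hs : IsLogIncrement g (f 0) s) : p - q + r - s = 0 := by
  obtain ⟨L, hL, hexp⟩ := exists_continuous_log (g := fun x ↦ f x.1 - g x.2) (by fun_prop)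
    (fun x ↦ sub_ne_zero.2 (hfg x.1 x.2))
  have row (t : ℝ) : IsLogIncrement f (g t) (L (1, t) - L (0, t)) :=
    ⟨fun s ↦ L (s, t), by fun_prop, fun s ↦ hexp (s, t), rfl⟩
  have col (s : ℝ) : IsLogIncrement g (f s) (L (s, 1) - L (s, 0)) := by
    refine ⟨fun t ↦ L (s, t) + Real.pi * Complex.I, by fun_prop, fun t ↦ ?_, by ring⟩
    rw [Complex.exp_add, Complex.exp_pi_mul_I, hexp]
    ring
  rw [hp.unique (row 0), hq.unique (row 1), hr.unique (col 1), hs.unique (col 0)]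
  ring

theorem exp_log_sub_max_min {z : Fin 5 → ℂ} {u v : Fin 5} (h : z u ≠ z v) :
    Complex.exp (Complex.log (z (max u v) - z (min u v))) =
      (if v < u then 1 else -1) * (z u - z v) := by
  have h' : z u - z v ≠ 0 := sub_ne_zero.2 h
  split_ifs with hlt
  · rw [max_eq_left hlt.le, min_eq_right hlt.le, Complex.exp_log h', one_mul]
  · rw [max_eq_right (not_lt.1 hlt), min_eq_left (not_lt.1 hlt), Complex.exp_log]
    · ring
    · exact sub_ne_zero.2 h.symm

theorem exists_int_eq_mul_pi {x : ℂ} {P : Prop} [Decidable P]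
    (h : Complex.exp x = if P then -1 else 1) :
    ∃ n : ℤ, x = n * (Real.pi * Complex.I) ∧ n % 2 = if P then 1 else 0 := by
  split_ifs at h ⊢
  · have h1 : Complex.exp (x - Real.pi * Complex.I) = 1 := by
      rw [Complex.exp_sub, h, Complex.exp_pi_mul_I, div_self (by norm_num)]
    obtain ⟨m, hm⟩ := Complex.exp_eq_one_iff.1 h1
    refine ⟨2 * m + 1, ?_, by omega⟩
    push_cast
    linear_combination hm
  · obtain ⟨m, hm⟩ := Complex.exp_eq_one_iff.1 h
    refine ⟨2 * m, ?_, by omega⟩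
    push_cast
    linear_combination hm

/-- The increment of the logarithm of `f - z v` along a curve from `z a` to `z b`, measured in
half-turns relative to the directions of the lines joining `z v` to `z a` and `z b`. -/
theorem IsLogIncrement.exists_int {z : Fin 5 → ℂ} {f : ℝ → ℂ} {a b v : Fin 5} (hab : a < b)
    (hf0 : f 0 = z a) (hf1 : f 1 = z b) (hva : v ≠ a)
    (hza : z a ≠ z v) (hzb : z b ≠ z v) {δ : ℂ} (h : IsLogIncrement f (z v) δ) :
    ∃ n : ℤ, δ = Complex.log (z (max b v) - z (min b v)) -
        Complex.log (z (max a v) - z (min a v)) + n * (Real.pi * Complex.I) ∧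
      n % 2 = if a < v ∧ v < b then 1 else 0 := by
  obtain ⟨l, -, hexp, rfl⟩ := h
  have hza' := sub_ne_zero.2 hza
  have hzb' := sub_ne_zero.2 hzb
  obtain ⟨n, hn, hpar⟩ := exists_int_eq_mul_pi (P := a < v ∧ v < b)
    (x := l 1 - l 0 - (Complex.log (z (max b v) - z (min b v)) -
        Complex.log (z (max a v) - z (min a v)))) (by
      rw [Complex.exp_sub, Complex.exp_sub, Complex.exp_sub, hexp, hexp, hf0, hf1,
        exp_log_sub_max_min hza, exp_log_sub_max_min hzb]
      by_cases h1 : v < a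
      · have h2 : v < b := h1.trans hab
        have h3 : ¬ a < v := h1.asymm
        simp only [h1, h2, h3, if_true, if_false, false_and]
        field_simp
      · have h3 : a < v := lt_of_le_of_ne (not_lt.1 h1) hva.symm
        by_cases h2 : v < b
        · simp only [h1, h2, h3, if_true, if_false, and_self]
          field_simp
        · simp only [h1, h2, h3, if_false, and_false]
          field_simp)
  exact ⟨n, by linear_combination hn, hpar⟩

/-- The complete graph on five vertices cannot be drawn in the plane so that vertex-disjoint
edges are drawn disjointly. -/
theorem false_of_planar_K5 (z : Fin 5 → ℂ) (f : Fin 5 → Fin 5 → ℝ → ℂ)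
    (hf : ∀ a b, a < b → Continuous (f a b)) (hf0 : ∀ a b, a < b → f a b 0 = z a)
    (hf1 : ∀ a b, a < b → f a b 1 = z b)
    (hdisj : ∀ a b c d, a < b → c < d → a ≠ c → a ≠ d → b ≠ c → b ≠ d →
      ∀ s t, f a b s ≠ f c d t) : False := by
  have hne : ∀ a b v, a < b → v ≠ a → v ≠ b → ∀ s, f a b s ≠ z v := by
    intro a b v hab hva hvb s
    obtain ⟨w, hwa, hwb, hwv⟩ : ∃ w : Fin 5, w ≠ a ∧ w ≠ b ∧ w ≠ v := by decide +revert
    rcases lt_or_gt_of_ne hwv with h | h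
    · rw [← hf1 w v h]
      exact hdisj a b w v hab h hwa.symm hva.symm hwb.symm hvb.symm s 1
    · rw [← hf0 v w h]
      exact hdisj a b v w hab h hva.symm hwa.symm hvb.symm hwb.symm s 0
  have hn : ∀ a b v : Fin 5, ∃ n : ℤ, a < b → v ≠ a → v ≠ b →
      IsLogIncrement (f a b) (z v) (Complex.log (z (max b v) - z (min b v)) -
        Complex.log (z (max a v) - z (min a v)) + n * (Real.pi * Complex.I)) ∧
      n % 2 = if a < v ∧ v < b then 1 else 0 := by
    intro a b v
    by_cases h : a < b ∧ v ≠ a ∧ v ≠ b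
    · obtain ⟨hab, hva, hvb⟩ := h
      obtain ⟨δ, hδ⟩ := exists_isLogIncrement (hf a b hab) (hne a b v hab hva hvb)
      obtain ⟨n, rfl, hpar⟩ := hδ.exists_int hab (hf0 a b hab) (hf1 a b hab) hva
        (hf0 a b hab ▸ hne a b v hab hva hvb 0) (hf1 a b hab ▸ hne a b v hab hva hvb 1)
      exact ⟨n, fun _ _ _ ↦ ⟨hδ, hpar⟩⟩
    · exact ⟨0, fun h1 h2 h3 ↦ (h ⟨h1, h2, h3⟩).elim⟩
  choose n hn using hn
  have hpar : ∀ a b v, a < b → v ≠ a → v ≠ b → n a b v % 2 = if a < v ∧ v < b then 1 else 0 :=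
    fun a b v h1 h2 h3 ↦ (hn a b v h1 h2 h3).2
  have hsq : ∀ a b c d, a < b → c < d → a ≠ c → a ≠ d → b ≠ c → b ≠ d →
      n a b c - n a b d + n c d b - n c d a = 0 := by
    intro a b c d hab hcd hac had hbc hbd
    have h := IsLogIncrement.square (hf a b hab) (hf c d hcd)
      (hdisj a b c d hab hcd hac had hbc hbd)
      (hf0 c d hcd ▸ (hn a b c hab hac.symm hbc.symm).1)
      (hf1 c d hcd ▸ (hn a b d hab had.symm hbd.symm).1)
      (hf1 a b hab ▸ (hn c d b hcd hbc hbd).1)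
      (hf0 a b hab ▸ (hn c d a hcd hac had).1)
    rw [max_comm c b, min_comm c b, max_comm d b, min_comm d b, max_comm c a, min_comm c a,
      max_comm d a, min_comm d a] at h
    have h2 : ((n a b c - n a b d + n c d b - n c d a : ℤ) : ℂ) * (Real.pi * Complex.I) = 0 := by
      push_cast
      linear_combination h
    have h3 : (Real.pi : ℂ) * Complex.I ≠ 0 :=
      mul_ne_zero (mod_cast Real.pi_ne_zero) Complex.I_ne_zero
    exact_mod_cast (mul_eq_zero.1 h2).resolve_right h3
  clear hn hne
  simp [Fin.forall_fin_succ] at hsq hpar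
  omega

theorem IsCurve.isPathConnected {s : Set Pt} (h : IsCurve s) : IsPathConnected s := by
  obtain ⟨f, hf, -, rfl⟩ := h
  exact ((convex_Icc (0 : ℝ) 1).isPathConnected ⟨0, by simp⟩).image' hf

theorem stmt14 (n : ℕ) {ι : Type*} (S : Fin n → Set Pt) (color : Fin n → Bool)
    (C : ι → Set Pt)
    (hScurve : ∀ i, IsPolygonalCurve (S i))
    (hCcurve : ∀ k, IsPolygonalCurve (C k))
    (hSinj : Function.Injective S)
    -- no two curves of the same color intersect
    (hsame : ∀ i j : Fin n, i ≠ j → color i = color j → Disjoint (S i) (S j))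
    -- every pair of curves intersects in finitely many points
    (hSCfin : ∀ i k, (S i ∩ C k).Finite)
    -- the curves of `C` are pairwise disjoint
    (hCdisj : ∀ k l : ι, k ≠ l → Disjoint (C k) (C l)) :
    -- the VC-dimension of the intersection hypergraph `H(S, C)` is at most 8:
    -- every shattered subset of `S` has at most 8 members
    ∀ V' : Set (Fin n),
      (∀ W ⊆ V', ∃ k : ι, {i : Fin n | (S i ∩ C k).Nonempty}.Nonempty ∧
        {i ∈ V' | (S i ∩ C k).Nonempty} = W) →
      V'.ncard ≤ 8 := by
  intro V' hV'
  by_contra! hcard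
  obtain ⟨e, he, heV, hecol⟩ : ∃ e : Fin 5 → Fin n, Function.Injective e ∧ (∀ i, e i ∈ V') ∧
      ∀ i j, color (e i) = color (e j) := by
    classical
    obtain ⟨c, -, hc⟩ := Finset.exists_lt_card_fiber_of_mul_lt_card_of_maps_to
      (s := V'.toFinset) (t := Finset.univ) (f := color) (n := 4) (by simp)
      (by rw [← Set.ncard_eq_toFinset_card']; simpa using hcard)
    obtain ⟨T, hT, hT5⟩ := Finset.exists_subset_card_eq (Nat.succ_le_of_lt hc)
    have hmem : ∀ i, T.orderEmbOfFin hT5 i ∈ V' ∧ color (T.orderEmbOfFin hT5 i) = c := fun i ↦ by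
      simpa using hT (T.orderEmbOfFin_mem hT5 i)
    exact ⟨T.orderEmbOfFin hT5, (T.orderEmbOfFin hT5).injective, fun i ↦ (hmem i).1,
      fun i j ↦ (hmem i).2.trans (hmem j).2.symm⟩
  have hk : ∀ a b : Fin 5, ∃ k, ∀ v, (S (e v) ∩ C k).Nonempty ↔ v = a ∨ v = b := by
    intro a b
    obtain ⟨k, -, hk⟩ := hV' {e a, e b} (by
      rintro _ (rfl | rfl)
      exacts [heV a, heV b])
    refine ⟨k, fun v ↦ ?_⟩
    have := Set.ext_iff.1 hk (e v)
    simpa [heV v, he.eq_iff] using this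
  choose k hk using hk
  have hSdisj : ∀ a b : Fin 5, a ≠ b → Disjoint (S (e a)) (S (e b)) := fun a b hab ↦
    hsame _ _ (he.ne hab) (hecol a b)
  have hSC : ∀ a b v : Fin 5, v ≠ a → v ≠ b → Disjoint (S (e v)) (C (k a b)) := by
    intro a b v hva hvb
    rw [Set.disjoint_iff_inter_eq_empty, ← Set.not_nonempty_iff_eq_empty, hk]
    tauto
  have hSp : ∀ i, IsPathConnected (S i) := fun i ↦ (hScurve i).1.isPathConnected
  have hCp : ∀ i, IsPathConnected (C i) := fun i ↦ (hCcurve i).1.isPathConnected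
  choose z hz using fun v ↦ (hSp (e v)).nonempty
  have hU : ∀ a b, JoinedIn (S (e a) ∪ C (k a b) ∪ S (e b)) (z a) (z b) := by
    intro a b
    have h1 : (S (e a) ∩ C (k a b)).Nonempty := (hk a b a).2 (Or.inl rfl)
    obtain ⟨x, hxb, hxC⟩ := (hk a b b).2 (Or.inr rfl)
    exact (((hSp _).union (hCp _) h1).union (hSp _) ⟨x, Or.inr hxC, hxb⟩).joinedIn _
      (Or.inl (Or.inl (hz a))) _ (Or.inr (hz b))
  let φ := Complex.equivRealProdCLM.symm
  refine false_of_planar_K5 (fun v ↦ φ (z v)) (fun a b s ↦ φ ((hU a b).somePath.extend s))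
    (fun a b _ ↦ φ.continuous.comp (hU a b).somePath.continuous_extend)
    (fun a b _ ↦ by simp) (fun a b _ ↦ by simp) ?_
  intro a b c d hab hcd hac had hbc hbd s t hst
  have hmem : ∀ a b s, (hU a b).somePath.extend s ∈ S (e a) ∪ C (k a b) ∪ S (e b) := by
    intro a b s
    have h : (hU a b).somePath.extend s ∈ Set.range (hU a b).somePath := by
      rw [← Path.extend_range]
      exact Set.mem_range_self s
    obtain ⟨t, ht⟩ := h
    rw [← ht]
    exact (hU a b).somePath_mem t
  have hkk : k a b ≠ k c d := by
    intro h
    have h1 := (hk a b a).2 (Or.inl rfl)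
    rw [h, hk] at h1
    tauto
  have hdisj : Disjoint (S (e a) ∪ C (k a b) ∪ S (e b)) (S (e c) ∪ C (k c d) ∪ S (e d)) := by
    simp only [Set.disjoint_union_left, Set.disjoint_union_right]
    exact ⟨⟨⟨⟨hSdisj a c hac, (hSC a b c hac.symm hbc.symm).symm⟩, hSdisj b c hbc⟩,
      ⟨hSC c d a hac had, hCdisj _ _ hkk⟩, hSC c d b hbc hbd⟩,
      ⟨hSdisj a d had, (hSC a b d had.symm hbd.symm).symm⟩, hSdisj b d hbd⟩
  exact Set.disjoint_left.1 hdisj (hmem a b s) (φ.injective hst ▸ hmem c d t)
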